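/- Fix h1 > h2 > 0, λ* ∈ (0,1), and constants 0 < c1 < 1 < c2 < ∞. There exist a positive integer K and constants c8 > 0, c9 > 0 such that for all λ ∈ [λ*,1), all integers M with c1/(1−λ) ≤ M ≤ c2/(1−λ) and M ≥ 2, all integers r with (|r|+2)K ≤ √(M−1), and every nonnegative integer j lying in the interval J_{r+1} = ( (M−1)β(λ,h1) + (r+1)Kσ(λ,h1), (M−1)β(λ,h1) + (r+2)Kσ(λ,h1) ), one has min( P(S_M(λ,h1) = j), P(S_M(λ,h2) = j) ) ≥ c8·c9/(K·√(M−1)). Here β(λ,t) = e^{−(1−λ)t} and σ(λ,t) are the mean and standard deviation of p_{λ,t}. -/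

import Mathlib

open Set Filter MeasureTheory

/-- Extinction-type parameter of the TKF91 model (deletion rate 1, insertion rate `lam`). -/
noncomputable def eta (lam t : ℝ) : ℝ :=
  (1 - Real.exp (-(1 - lam) * t)) / (1 - lam * Real.exp (-(1 - lam) * t))

/-- TKF91 mortal-link progeny-length pmf `p_{λ,t}`. -/
noncomputable def pTKF (lam t : ℝ) : ℕ → ℝ
  | 0 => eta lam t
  | (n + 1) => (1 - eta lam t) * (1 - lam * eta lam t) * (lam * eta lam t) ^ n

/-- TKF91 immortal-link progeny pmf `q_{λ,t}`. -/
noncomputable def qTKF (lam t : ℝ) (n : ℕ) : ℝ :=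
  (1 - lam * eta lam t) * (lam * eta lam t) ^ n

/-- pmf of `S_M(λ,t)`, a sum of `M` i.i.d. variables with law `p_{λ,t}`
(`M`-fold convolution of `pTKF lam t`). -/
noncomputable def pS (lam t : ℝ) : ℕ → ℕ → ℝ
  | 0 => fun n => if n = 0 then 1 else 0
  | (M + 1) => fun n => ∑ k ∈ Finset.range (n + 1), pS lam t M k * pTKF lam t (n - k)

/-- pmf of the leaf sequence length `N = G + S_M(λ,t)` with `G ~ q_{λ,t}` independent. -/
noncomputable def pLeaf (lam t : ℝ) (M n : ℕ) : ℝ :=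
  ∑ k ∈ Finset.range (n + 1), qTKF lam t k * pS lam t M (n - k)

/-- Joint distribution on `ℕ × ℕ` of the pair of leaf lengths of the two-leaf star tree
of height `h`, with stationary geometric root length. -/
noncomputable def Ldist (lam h : ℝ) (y : ℕ × ℕ) : ℝ :=
  ∑' M : ℕ, (1 - lam) * lam ^ M * (pLeaf lam h M y.1 * pLeaf lam h M y.2)

/-- Mean of `p_{λ,t}`. -/
noncomputable def betaTKF (lam t : ℝ) : ℝ := Real.exp (-(1 - lam) * t)

/-- Standard deviation of `p_{λ,t}`. -/
noncomputable def sdev (lam t : ℝ) : ℝ :=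
  Real.sqrt (∑' n : ℕ, ((n : ℝ) - betaTKF lam t) ^ 2 * pTKF lam t n)

/-- `P(S_M(λ,t) ∈ (a,b))`. -/
noncomputable def probIn (lam t : ℝ) (M : ℕ) (a b : ℝ) : ℝ :=
  ∑' j : ℕ, if (j : ℝ) ∈ Set.Ioo a b then pS lam t M j else 0

/-- CDF of `S_M(λ,t)`. -/
noncomputable def cdfS (lam t : ℝ) (M : ℕ) (x : ℝ) : ℝ :=
  ∑' j : ℕ, if (j : ℝ) ≤ x then pS lam t M j else 0

/-- Standard normal CDF. -/
noncomputable def stdNormalCDF (x : ℝ) : ℝ :=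
  ∫ u in Set.Iic x, Real.exp (-u ^ 2 / 2) / Real.sqrt (2 * Real.pi)


noncomputable def binP (n : ℕ) (p : ℝ) (k : ℕ) : ℝ :=
  (n.choose k : ℝ) * p ^ k * (1 - p) ^ (n - k)

lemma binP_nonneg {n : ℕ} {p : ℝ} {k : ℕ} (h0 : 0 ≤ p) (h1 : p ≤ 1) : 0 ≤ binP n p k := by
  unfold binP
  have : 0 ≤ 1 - p := by linarith
  positivity

lemma binP_step {n : ℕ} {p : ℝ} {k : ℕ} (hk : k < n) :
    ((k : ℝ) + 1) * (1 - p) * binP n p (k + 1) = ((n : ℝ) - k) * p * binP n p k := by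
  have h := Nat.choose_succ_right_eq n k
  have h' : (n.choose (k + 1) : ℝ) * ((k : ℝ) + 1) = (n.choose k : ℝ) * ((n : ℝ) - k) := by
    rw [← Nat.cast_sub hk.le]; exact_mod_cast h
  have e : n - k = (n - (k + 1)) + 1 := by omega
  unfold binP
  rw [e, pow_succ, pow_succ]
  linear_combination (p ^ k * p * (1 - p) ^ (n - (k + 1)) * (1 - p)) * h'

lemma binP_sum (n : ℕ) (p : ℝ) : ∑ k ∈ Finset.range (n + 1), binP n p k = 1 := by
  have h := congrArg (Polynomial.eval p) (bernsteinPolynomial.sum ℝ n)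
  simpa [Polynomial.eval_finsetSum, bernsteinPolynomial, binP] using h

lemma binP_var (n : ℕ) (p : ℝ) :
    ∑ k ∈ Finset.range (n + 1), ((n : ℝ) * p - k) ^ 2 * binP n p k = n * p * (1 - p) := by
  have h := congrArg (Polynomial.eval p) (bernsteinPolynomial.variance ℝ n)
  simpa [Polynomial.eval_finsetSum, bernsteinPolynomial, binP, mul_assoc] using h

lemma binP_exists {n : ℕ} {p : ℝ} (hn : 1 ≤ n) (h0 : 0 ≤ p) (h1 : p ≤ 1) :
    ∃ k : ℕ, |(k : ℝ) - n * p| ≤ √n ∧ 1 / (4 * √n) ≤ binP n p k := by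
  by_contra hcon
  push Not at hcon
  have hn' : (1 : ℝ) ≤ n := by exact_mod_cast hn
  have hs : 1 ≤ √(n : ℝ) := by rw [Real.one_le_sqrt]; exact hn'
  have hsq : √(n : ℝ) ^ 2 = n := Real.sq_sqrt (by linarith)
  set s := √(n : ℝ) with hsdef
  set W := (Finset.range (n + 1)).filter (fun k : ℕ => |(k : ℝ) - n * p| ≤ s) with hW
  have hsplit : ∑ k ∈ W, binP n p k
      + ∑ k ∈ (Finset.range (n + 1)).filter (fun k : ℕ => ¬ |(k : ℝ) - n * p| ≤ s), binP n p k = 1 := by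
    rw [hW, Finset.sum_filter_add_sum_filter_not, binP_sum]
  have htail : (n : ℝ) * ∑ k ∈ (Finset.range (n + 1)).filter (fun k : ℕ => ¬ |(k : ℝ) - n * p| ≤ s), binP n p k
      ≤ n * p * (1 - p) := by
    rw [← binP_var, Finset.mul_sum]
    refine le_trans (Finset.sum_le_sum (g := fun k : ℕ => ((n : ℝ) * p - k) ^ 2 * binP n p k) ?_) ?_
    · intro k hk
      have hk2 := (Finset.mem_filter.1 hk).2
      push Not at hk2
      refine mul_le_mul_of_nonneg_right ?_ (binP_nonneg h0 h1)
      refine hsq.symm.le.trans ?_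
      rw [← sq_abs ((n : ℝ) * p - k), abs_sub_comm]
      gcongr
    · refine Finset.sum_le_sum_of_subset_of_nonneg (Finset.filter_subset _ _) ?_
      intro k _ _
      exact mul_nonneg (sq_nonneg _) (binP_nonneg h0 h1)
  have htail2 : ∑ k ∈ (Finset.range (n + 1)).filter (fun k : ℕ => ¬ |(k : ℝ) - n * p| ≤ s), binP n p k
      ≤ 1 / 4 := by
    have : p * (1 - p) ≤ 1 / 4 := by nlinarith [sq_nonneg (p - 1 / 2)]
    have h3 : (n : ℝ) * ∑ k ∈ (Finset.range (n + 1)).filter (fun k : ℕ => ¬ |(k : ℝ) - n * p| ≤ s), binP n p k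
      ≤ n * (1 / 4) := by nlinarith
    exact le_of_mul_le_mul_left h3 (by linarith)
  have hsub : W ⊆ Finset.Icc ⌈(n : ℝ) * p - s⌉₊ ⌊(n : ℝ) * p + s⌋₊ := by
    intro k hk
    have hk2 := abs_le.1 (Finset.mem_filter.1 hk).2
    rw [Finset.mem_Icc]
    exact ⟨Nat.ceil_le.2 (by linarith [hk2.1]), Nat.le_floor (by linarith [hk2.2])⟩
  have hnp : 0 ≤ (n : ℝ) * p := by positivity
  have hcard : (W.card : ℝ) ≤ 3 * s := by
    have h4 := Finset.card_le_card hsub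
    rw [Nat.card_Icc] at h4
    have hfl : (⌊(n : ℝ) * p + s⌋₊ : ℝ) ≤ n * p + s := Nat.floor_le (by linarith)
    have hce : (n : ℝ) * p - s ≤ ⌈(n : ℝ) * p - s⌉₊ := Nat.le_ceil _
    have h4' : (W.card : ℝ) ≤ ((⌊(n : ℝ) * p + s⌋₊ + 1 - ⌈(n : ℝ) * p - s⌉₊ : ℕ) : ℝ) := by
      exact_mod_cast h4
    rcases le_total ⌈(n : ℝ) * p - s⌉₊ (⌊(n : ℝ) * p + s⌋₊ + 1) with h5 | h5
    · rw [Nat.cast_sub h5] at h4'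
      push_cast at h4'
      linarith
    · rw [Nat.sub_eq_zero_of_le h5] at h4'
      push_cast at h4'
      linarith
  have hne : W.Nonempty := by
    rw [Finset.nonempty_iff_ne_empty]
    intro h
    rw [h] at hsplit
    simp only [Finset.sum_empty] at hsplit
    linarith
  have hlt : ∑ k ∈ W, binP n p k < ∑ k ∈ W, 1 / (4 * s) := by
    refine Finset.sum_lt_sum_of_nonempty hne ?_
    intro k hk
    exact hcon k (Finset.mem_filter.1 hk).2
  rw [Finset.sum_const, nsmul_eq_mul] at hlt
  have : (W.card : ℝ) * (1 / (4 * s)) ≤ 3 * s * (1 / (4 * s)) := by gcongr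
  have h6 : 3 * s * (1 / (4 * s)) = 3 / 4 := by field_simp
  linarith

lemma binP_ratio {n : ℕ} {p p0 A : ℝ} {k : ℕ} (hA : 1 ≤ A) (hp0 : 0 < p0) (hp : p0 ≤ p)
    (hp1 : p ≤ 1 - p0) (hn : 2 * A / p0 ≤ √n)
    (hk : |(k : ℝ) - n * p| ≤ A * √n) (hk1 : |((k + 1 : ℕ) : ℝ) - n * p| ≤ A * √n) :
    binP n p k ≤ Real.exp (4 * A / p0 ^ 2 / √n) * binP n p (k + 1) ∧
    binP n p (k + 1) ≤ Real.exp (4 * A / p0 ^ 2 / √n) * binP n p k := by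
  have hs0 : 0 < √(n : ℝ) := lt_of_lt_of_le (by positivity) hn
  have hsq : √(n : ℝ) ^ 2 = n := Real.sq_sqrt (Nat.cast_nonneg n)
  have hn1 : (1 : ℝ) ≤ √n := by
    refine le_trans ?_ hn
    rw [le_div_iff₀ hp0]; linarith
  set s := √(n : ℝ) with hsdef
  rw [div_le_iff₀ hp0] at hn
  have hAs : 2 * (A * s) ≤ p0 * n := by rw [← hsq]; nlinarith
  rw [abs_le] at hk hk1
  push_cast at hk1
  have hnk : p0 * n / 2 ≤ (n : ℝ) - k := by nlinarith
  have hkk : p0 * n / 2 ≤ (k : ℝ) + 1 := by nlinarith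
  have hnpos : 0 < (n : ℝ) := by rw [← hsq]; positivity
  have hkn : k < n := by
    have : (k : ℝ) < n := by nlinarith [mul_pos hp0 hnpos]
    exact_mod_cast this
  have hstep := binP_step (p := p) hkn
  set x := 4 * A / p0 ^ 2 / s with hx
  have hx0 : 0 ≤ x := by positivity
  have hex : 1 + x ≤ Real.exp x := by linarith [Real.add_one_le_exp x]
  have hxe : x * (p0 * n / 2 * p0) = 2 * A * s := by
    rw [hx, ← hsq]; field_simp; norm_num
  have hb0 : 0 ≤ binP n p k := binP_nonneg (by linarith) (by linarith)
  have hb1 : 0 ≤ binP n p (k + 1) := binP_nonneg (by linarith) (by linarith)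
  have hAs1 : 1 ≤ A * s := by nlinarith
  set u := ((n : ℝ) - k) * p with hu
  set v := ((k : ℝ) + 1) * (1 - p) with hv
  have hun : p0 * n / 2 * p0 ≤ u := by rw [hu]; gcongr; linarith [mul_pos hp0 hnpos]
  have hvn : p0 * n / 2 * p0 ≤ v := by rw [hv]; gcongr; linarith
  have hpos : 0 < p0 * n / 2 * p0 := by positivity
  have huv : v ≤ u * (1 + x) := by
    have : x * (p0 * n / 2 * p0) ≤ x * u := by gcongr
    have e : v - u = (k + 1 - n * p) - p := by rw [hu, hv]; ring
    nlinarith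
  have hvu : u ≤ v * (1 + x) := by
    have : x * (p0 * n / 2 * p0) ≤ x * v := by gcongr
    have e : v - u = (k + 1 - n * p) - p := by rw [hu, hv]; ring
    nlinarith
  constructor
  · refine le_of_mul_le_mul_left ?_ (lt_of_lt_of_le hpos hun)
    rw [← hstep]
    calc v * binP n p (k + 1) ≤ (u * Real.exp x) * binP n p (k + 1) := by
          gcongr; exact huv.trans (by gcongr; linarith)
      _ = _ := by ring
  · refine le_of_mul_le_mul_left ?_ (lt_of_lt_of_le hpos hvn)
    rw [hstep]
    calc u * binP n p k ≤ (v * Real.exp x) * binP n p k := by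
          gcongr; exact hvu.trans (by gcongr; linarith)
      _ = _ := by ring

lemma binP_chain {n : ℕ} {p p0 A : ℝ} (hA : 1 ≤ A) (hp0 : 0 < p0) (hp : p0 ≤ p)
    (hp1 : p ≤ 1 - p0) (hn : 2 * A / p0 ≤ √n) (k d : ℕ) 
    (hk : |(k : ℝ) - n * p| ≤ A * √n) (hk1 : |((k + d : ℕ) : ℝ) - n * p| ≤ A * √n) :
    binP n p k ≤ Real.exp (d * (4 * A / p0 ^ 2 / √n)) * binP n p (k + d) ∧
    binP n p (k + d) ≤ Real.exp (d * (4 * A / p0 ^ 2 / √n)) * binP n p k := by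
  induction d with
  | zero => simp
  | succ d ih =>
    have hm : |((k + d : ℕ) : ℝ) - n * p| ≤ A * √n := by
      rw [abs_le] at hk hk1 ⊢
      push_cast at hk1 ⊢
      have : (0 : ℝ) ≤ d := Nat.cast_nonneg d
      constructor <;> linarith [hk.1, hk1.2]
    obtain ⟨i1, i2⟩ := ih hm
    obtain ⟨r1, r2⟩ := binP_ratio hA hp0 hp hp1 hn hm hk1
    set x := 4 * A / p0 ^ 2 / √n
    have e : Real.exp (((d + 1 : ℕ) : ℝ) * x) = Real.exp (d * x) * Real.exp x := by
      rw [← Real.exp_add]; congr 1; push_cast; ring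
    rw [e]
    constructor
    · calc _ ≤ _ := i1
        _ ≤ Real.exp (d * x) * (Real.exp x * binP n p (k + d + 1)) := by gcongr
        _ = _ := by rw [← add_assoc]; ring
    · calc _ ≤ _ := r2
        _ ≤ Real.exp x * (Real.exp (d * x) * binP n p k) := by gcongr
        _ = _ := by ring

lemma binP_lower {n : ℕ} {p p0 A : ℝ} (hA : 1 ≤ A) (hp0 : 0 < p0) (hp : p0 ≤ p)
    (hp1 : p ≤ 1 - p0) (hn : 2 * A / p0 ≤ √n) (k : ℕ) (hk : |(k : ℝ) - n * p| ≤ A * √n) :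
    Real.exp (-(8 * A ^ 2 / p0 ^ 2)) / 4 / √n ≤ binP n p k := by
  have hs0 : 0 < √(n : ℝ) := lt_of_lt_of_le (by positivity) hn
  have hn1 : 1 ≤ n := by
    have := Real.sqrt_pos.1 hs0
    exact_mod_cast this
  obtain ⟨k0, h1, h2⟩ := binP_exists hn1 (show 0 ≤ p by linarith) (by linarith)
  have hk0 : |(k0 : ℝ) - n * p| ≤ A * √n := h1.trans (by nlinarith)
  have key : ∀ d : ℕ, (d : ℝ) ≤ 2 * (A * √n) →
      Real.exp (d * (4 * A / p0 ^ 2 / √n)) ≤ Real.exp (8 * A ^ 2 / p0 ^ 2) := by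
    intro d hd
    rw [Real.exp_le_exp]
    calc d * (4 * A / p0 ^ 2 / √n) ≤ 2 * (A * √n) * (4 * A / p0 ^ 2 / √n) := by gcongr
      _ = _ := by field_simp; norm_num
  have hb : 0 ≤ binP n p k := binP_nonneg (by linarith) (by linarith)
  have main : binP n p k0 ≤ Real.exp (8 * A ^ 2 / p0 ^ 2) * binP n p k := by
    have a1 := abs_le.1 hk
    have a2 := abs_le.1 hk0
    rcases le_total k k0 with h | h
    · obtain ⟨d, rfl⟩ := Nat.exists_eq_add_of_le h
      push_cast at a2
      exact (binP_chain hA hp0 hp hp1 hn k d hk hk0).2.trans (mul_le_mul_of_nonneg_right (key d (by linarith)) (binP_nonneg (by linarith) (by linarith)))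
    · obtain ⟨d, rfl⟩ := Nat.exists_eq_add_of_le h
      push_cast at a1
      exact (binP_chain hA hp0 hp hp1 hn k0 d hk0 hk).1.trans (mul_le_mul_of_nonneg_right (key d (by linarith)) (binP_nonneg (by linarith) (by linarith)))
  have h3 := h2.trans main
  rw [Real.exp_neg]
  have hE := Real.exp_pos (8 * A ^ 2 / p0 ^ 2)
  have h4 : (Real.exp (8 * A ^ 2 / p0 ^ 2))⁻¹ * (1 / (4 * √n)) ≤ binP n p k := by
    rw [inv_mul_le_iff₀ hE]; exact h3
  calc _ = (Real.exp (8 * A ^ 2 / p0 ^ 2))⁻¹ * (1 / (4 * √n)) := by field_simp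
    _ ≤ _ := h4

lemma pS_eq_coeff (lam t : ℝ) (M n : ℕ) :
    pS lam t M n = PowerSeries.coeff n ((PowerSeries.mk (pTKF lam t)) ^ M) := by
  induction M generalizing n with
  | zero => simp [pS, PowerSeries.coeff_one]
  | succ M ih =>
    rw [pow_succ, PowerSeries.coeff_mul, Finset.Nat.sum_antidiagonal_eq_sum_range_succ_mk]
    simp only [pS, PowerSeries.coeff_mk]
    exact Finset.sum_congr rfl fun k _ => by rw [ih]

lemma mk_pTKF (lam t : ℝ) : PowerSeries.mk (pTKF lam t) =
    PowerSeries.X * (PowerSeries.C ((1 - eta lam t) * (1 - lam * eta lam t)) *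
      PowerSeries.rescale (lam * eta lam t) (PowerSeries.mk 1)) + PowerSeries.C (eta lam t) := by
  ext n
  cases n with
  | zero => simp [pTKF]
  | succ n =>
    rw [map_add, PowerSeries.coeff_succ_X_mul, PowerSeries.coeff_C_mul, PowerSeries.coeff_rescale,
      PowerSeries.coeff_C]
    simp [pTKF]

lemma pS_formula (lam t : ℝ) (M j : ℕ) :
    pS lam t M (j + 1) = ∑ b ∈ Finset.range M, 
      binP M (1 - eta lam t) (b + 1) * (1 - lam * eta lam t) * binP j (1 - lam * eta lam t) b := by
  rw [pS_eq_coeff, mk_pTKF, add_pow, map_sum, Finset.sum_range_succ']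
  have hz : (PowerSeries.coeff (j + 1)) ((PowerSeries.X * (PowerSeries.C ((1 - eta lam t) * (1 - lam * eta lam t)) *
      PowerSeries.rescale (lam * eta lam t) (PowerSeries.mk 1))) ^ 0 * PowerSeries.C (eta lam t) ^ (M - 0)
        * ((M.choose 0 : ℕ) : PowerSeries ℝ)) = 0 := by
    simp [← map_pow]
  rw [hz, add_zero]
  refine Finset.sum_congr rfl fun b _ => ?_
  have e : (PowerSeries.X * (PowerSeries.C ((1 - eta lam t) * (1 - lam * eta lam t)) *
      PowerSeries.rescale (lam * eta lam t) (PowerSeries.mk 1))) ^ (b + 1)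
        * PowerSeries.C (eta lam t) ^ (M - (b + 1))
        * ((M.choose (b + 1) : ℕ) : PowerSeries ℝ) =
      PowerSeries.C (((1 - eta lam t) * (1 - lam * eta lam t)) ^ (b + 1) *
        (eta lam t) ^ (M - (b + 1)) * (M.choose (b + 1) : ℝ)) *
      (PowerSeries.X ^ (b + 1) * PowerSeries.rescale (lam * eta lam t)
        (PowerSeries.mk fun n => ((b + n).choose b : ℝ))) := by
    rw [← PowerSeries.mk_one_pow_eq_mk_choose_add]
    simp only [map_mul, map_pow, map_natCast, mul_pow]
    ring
  rw [e, PowerSeries.coeff_C_mul, PowerSeries.coeff_X_pow_mul']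
  unfold binP
  split_ifs with h
  · rw [PowerSeries.coeff_rescale, PowerSeries.coeff_mk]
    have e1 : j + 1 - (b + 1) = j - b := by omega
    have e2 : b + (j - b) = j := by omega
    rw [e1, e2]
    simp only [sub_sub_cancel, mul_pow]
    ring
  · rw [Nat.choose_eq_zero_of_lt (show j < b by omega)]
    simp

lemma eta_bounds {lam t : ℝ} (ht : 0 < t) (h0 : 0 < lam) (h1 : lam < 1) :
    t / (1 + t) ≤ eta lam t ∧ eta lam t ≤ t / (t + Real.exp (-t)) := by
  unfold eta
  set e := Real.exp (-(1 - lam) * t) with he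
  have hepos : 0 < e := Real.exp_pos _
  have hx : 0 < (1 - lam) * t := mul_pos (by linarith) ht
  have he1 : e < 1 := by rw [he, Real.exp_lt_one_iff]; linarith
  have hD : 0 < 1 - lam * e := by nlinarith
  have hlow : 1 - (1 - lam) * t ≤ e := by
    have := Real.add_one_le_exp (-(1 - lam) * t)
    linarith
  have hup : (1 + (1 - lam) * t) * e ≤ 1 := by
    have h := Real.add_one_le_exp ((1 - lam) * t)
    have h2 : Real.exp ((1 - lam) * t) * e = 1 := by
      rw [he, ← Real.exp_add, neg_mul, add_neg_cancel, Real.exp_zero]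
    nlinarith
  have het : Real.exp (-t) ≤ e := by
    rw [he, Real.exp_le_exp]; nlinarith
  have hetpos := Real.exp_pos (-t)
  constructor
  · rw [div_le_div_iff₀ (by linarith) hD]
    nlinarith
  · rw [div_le_div_iff₀ hD (by linarith)]
    have h3 : (1 - e) * Real.exp (-t) ≤ ((1 - lam) * t) * e := by
      apply mul_le_mul (by linarith) het hetpos.le hx.le
    nlinarith

lemma pS_lower (t ls c2 A0 : ℝ) (ht : 0 < t) (hls : 0 < ls) (hc2 : 0 < c2) (hA0 : 0 ≤ A0) :
    ∃ c : ℝ, 0 < c ∧ ∃ N : ℝ, ∀ lam : ℝ, ls ≤ lam → lam < 1 → ∀ M : ℕ, N ≤ √(M : ℝ) →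
      (M : ℝ) * (1 - lam) ≤ c2 → ∀ j : ℕ, |(j : ℝ) - M| ≤ A0 * √(M : ℝ) →
      c / √(M : ℝ) ≤ pS lam t M j := by
  set η0 := t / (1 + t) with hη0
  set η1 := t / (t + Real.exp (-t)) with hη1
  have h0pos : 0 < η0 := by positivity
  have h1lt : η1 < 1 := by
    rw [hη1, div_lt_one (by positivity)]; linarith [Real.exp_pos (-t)]
  set p0 := min (1 - η1) (ls * η0) with hp0
  have hp0pos : 0 < p0 := lt_min (by linarith) (by positivity)
  have hp0a : p0 ≤ 1 - η1 := min_le_left _ _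
  have hp0b : p0 ≤ ls * η0 := min_le_right _ _
  set A := 2 * (A0 + c2 + 4) with hA
  have hA1 : 1 ≤ A := by rw [hA]; linarith
  set κ := Real.exp (-(8 * A ^ 2 / p0 ^ 2)) / 4 with hκ
  have hκpos : 0 < κ := by positivity
  refine ⟨κ ^ 2 * p0 / 4, by positivity, max (4 * A / p0) (2 * (A0 + 1)), ?_⟩
  intro lam hlam hlam1 M hN hM j hj
  set s := √(M : ℝ) with hs
  have hNa : 4 * A / p0 ≤ s := (le_max_left _ _).trans hN
  have hNb : 2 * (A0 + 1) ≤ s := (le_max_right _ _).trans hN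
  have hs2 : 2 ≤ s := by linarith
  have hsq : s ^ 2 = M := Real.sq_sqrt (Nat.cast_nonneg M)
  obtain ⟨hb0, hb1⟩ := eta_bounds ht (lt_of_lt_of_le hls hlam) hlam1
  rw [← hη0] at hb0
  rw [← hη1] at hb1
  obtain ⟨hj1, hj2⟩ := abs_le.1 hj
  have hA0s : A0 * s + s ≤ s ^ 2 / 2 := by
    have := mul_le_mul_of_nonneg_right hNb (show 0 ≤ s by linarith)
    linarith [sq s]
  have hs2s : 2 * s ≤ s ^ 2 := by
    have := mul_le_mul_of_nonneg_right hs2 (show 0 ≤ s by linarith)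
    linarith [sq s]
  have hjge : s ^ 2 / 4 + 1 ≤ (j : ℝ) := by linarith
  have hjpos : 1 ≤ j := by
    have : (1 : ℝ) ≤ j := by linarith
    exact_mod_cast this
  obtain ⟨j', rfl⟩ := Nat.exists_eq_add_of_le' hjpos
  push_cast at hjge hj1 hj2
  rw [pS_formula]
  set η := eta lam t with hη
  set P := 1 - lam * η with hP
  set p := 1 - η with hp
  have hηpos : 0 < η := lt_of_lt_of_le h0pos hb0
  have hlη : ls * η0 ≤ lam * η := by gcongr; linarith
  have hlη' : lam * η ≤ η := mul_le_of_le_one_left hηpos.le hlam1.le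
  have hpa : p0 ≤ p := by rw [hp]; linarith
  have hpb : p ≤ 1 - p0 := by rw [hp]; linarith
  have hPa : p0 ≤ P := by rw [hP]; linarith
  have hPb : P ≤ 1 - p0 := by rw [hP]; linarith
  have hsj1 : s / 2 ≤ √(j' : ℝ) := by
    apply Real.le_sqrt_of_sq_le; rw [div_pow]; linarith
  have hsj2 : √(j' : ℝ) ≤ 2 * s := by
    rw [Real.sqrt_le_left (by linarith), mul_pow]; linarith
  have hMp : 0 ≤ (M : ℝ) * p := mul_nonneg (Nat.cast_nonneg M) (by linarith)
  set B := ⌊(M : ℝ) * p⌋₊ with hB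
  set L := ⌊s⌋₊ with hL
  have hB1 : (B : ℝ) ≤ M * p := Nat.floor_le hMp
  have hB2 : (M : ℝ) * p < B + 1 := Nat.lt_floor_add_one _
  have hL1 : (L : ℝ) ≤ s := Nat.floor_le (by linarith)
  have hL2 : s < L + 1 := Nat.lt_floor_add_one _
  have hw : ∀ b ∈ Finset.Ico B (B + L), 
      κ / s ≤ binP M p (b + 1) ∧ κ / (2 * s) ≤ binP j' P b := by
    intro b hb
    rw [Finset.mem_Ico] at hb
    have hb1 : (B : ℝ) ≤ b := by exact_mod_cast hb.1
    have hb2 : (b : ℝ) + 1 ≤ B + L := by exact_mod_cast hb.2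
    constructor
    · refine binP_lower hA1 hp0pos hpa hpb ?_ (b + 1) ?_
      · refine le_trans ?_ hNa
        gcongr; norm_num
      · rw [← hs, abs_le]
        push_cast
        have : s ≤ A * s := le_mul_of_one_le_left (by linarith) hA1
        constructor <;> linarith
    · refine le_trans ?_ (binP_lower hA1 hp0pos hPa hPb (le_trans ?_ hsj1) b ?_)
      · rw [← hκ]
        gcongr
        exact lt_of_lt_of_le (by linarith) hsj1
      · have e : 4 * A / p0 = 2 * (2 * A / p0) := by ring
        linarith
      · have e : (b : ℝ) - j' * P = ((b : ℝ) + 1 - M * p) - 1 + ((M - (j' + 1)) * P - (M * (1 - lam)) * η) + P := by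
          rw [hp, hP]; ring
        have a1 : |(M - ((j' : ℝ) + 1)) * P| ≤ A0 * s := by
          rw [abs_mul, abs_of_pos (show 0 < P by linarith)]
          have : |(M : ℝ) - ((j' : ℝ) + 1)| ≤ A0 * s := by rw [abs_le]; constructor <;> linarith
          exact (mul_le_of_le_one_right (abs_nonneg _) (by linarith)).trans this
        have hM0 : 0 ≤ (M : ℝ) * (1 - lam) := mul_nonneg (Nat.cast_nonneg M) (by linarith)
        have a2 : (M * (1 - lam)) * η ≤ c2 :=
          (mul_le_of_le_one_right hM0 (by linarith)).trans hM
        have a3 : 0 ≤ (M * (1 - lam)) * η := by positivity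
        have a4 := abs_le.1 a1
        have a5 : (A0 + c2 + 4) * s ≤ A * √(j' : ℝ) := by
          have := mul_le_mul_of_nonneg_left hsj1 (show 0 ≤ A by linarith)
          have e2 : A * (s / 2) = (A0 + c2 + 4) * s := by rw [hA]; ring
          linarith
        have a6 : A0 * s + c2 + 2 + s ≤ (A0 + c2 + 4) * s := by
          have := mul_le_mul_of_nonneg_left (show 1 ≤ s by linarith) hc2.le
          linarith
        rw [e, abs_le]
        constructor <;> linarith
  have hsub : Finset.Ico B (B + L) ⊆ Finset.range M := by
    intro b hb
    have h := (hw b hb).1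
    have hpos : 0 < binP M p (b + 1) := lt_of_lt_of_le (by positivity) h
    rw [Finset.mem_range]
    by_contra hcon
    unfold binP at hpos
    rw [Nat.choose_eq_zero_of_lt (show M < b + 1 by omega)] at hpos
    simp at hpos
  have hPp : 0 ≤ P := by linarith
  calc κ ^ 2 * p0 / 4 / s = (s / 2) * (κ / s * p0 * (κ / (2 * s))) := by field_simp; norm_num
    _ ≤ (L : ℝ) * (κ / s * p0 * (κ / (2 * s))) := by gcongr; linarith
    _ = ∑ b ∈ Finset.Ico B (B + L), κ / s * p0 * (κ / (2 * s)) := by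
        rw [Finset.sum_const, Nat.card_Ico, nsmul_eq_mul]; simp
    _ ≤ ∑ b ∈ Finset.Ico B (B + L), binP M p (b + 1) * P * binP j' P b := by
        refine Finset.sum_le_sum fun b hb => ?_
        obtain ⟨w1, w2⟩ := hw b hb
        have : 0 ≤ binP M p (b + 1) := binP_nonneg (by linarith) (by linarith)
        gcongr
    _ ≤ _ := by
        refine Finset.sum_le_sum_of_subset_of_nonneg hsub fun b _ _ => ?_
        exact mul_nonneg (mul_nonneg (binP_nonneg (by linarith) (by linarith)) hPp)
          (binP_nonneg (by linarith) (by linarith))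

lemma sdev_bound (t : ℝ) (ht : 0 < t) : 
    ∃ C : ℝ, 0 ≤ C ∧ ∀ lam : ℝ, 0 < lam → lam < 1 → sdev lam t ≤ C := by
  set η1 := t / (t + Real.exp (-t)) with hη1
  have h1pos : 0 < η1 := by positivity
  have h1lt : η1 < 1 := by
    rw [hη1, div_lt_one (by positivity)]; linarith [Real.exp_pos (-t)]
  have hsum : Summable (fun n : ℕ => ((n : ℝ) + 1) ^ 2 * (η1⁻¹ * η1 ^ n)) := by
    have hr : ‖η1‖ < 1 := by rw [Real.norm_eq_abs, abs_of_pos h1pos]; exact h1lt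
    have s2 := summable_pow_mul_geometric_of_norm_lt_one 2 hr
    have s1 := summable_pow_mul_geometric_of_norm_lt_one 1 hr
    have s0 := summable_pow_mul_geometric_of_norm_lt_one 0 hr
    refine (((s2.add (s1.mul_left 2)).add s0).mul_left η1⁻¹).congr fun n => ?_
    ring
  refine ⟨√(∑' n : ℕ, ((n : ℝ) + 1) ^ 2 * (η1⁻¹ * η1 ^ n)), Real.sqrt_nonneg _, ?_⟩
  intro lam h0 h1
  obtain ⟨hb0, hb1⟩ := eta_bounds ht h0 h1
  have hη0 : 0 < eta lam t := lt_of_lt_of_le (by positivity) hb0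
  rw [← hη1] at hb1
  have hβ0 : 0 < betaTKF lam t := Real.exp_pos _
  have hβ1 : betaTKF lam t ≤ 1 := by
    unfold betaTKF; rw [Real.exp_le_one_iff]; nlinarith
  have hle : lam * eta lam t ≤ η1 := by nlinarith
  have hpos : 0 < lam * eta lam t := by positivity
  have hp : ∀ n, 0 ≤ pTKF lam t n ∧ pTKF lam t n ≤ η1⁻¹ * η1 ^ n := by
    intro n
    cases n with
    | zero =>
      simp only [pTKF, pow_zero, mul_one]
      exact ⟨hη0.le, (hb1.trans h1lt.le).trans ((one_le_inv₀ h1pos).2 h1lt.le)⟩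
    | succ n =>
      simp only [pTKF]
      have q1 : 0 ≤ 1 - eta lam t := by linarith
      have q2 : 0 ≤ 1 - lam * eta lam t := by linarith
      refine ⟨by positivity, ?_⟩
      have e : η1⁻¹ * η1 ^ (n + 1) = 1 * η1 ^ n := by rw [pow_succ]; field_simp
      rw [e]
      gcongr
      nlinarith
  have hterm : ∀ n : ℕ, ((n : ℝ) - betaTKF lam t) ^ 2 * pTKF lam t n
      ≤ ((n : ℝ) + 1) ^ 2 * (η1⁻¹ * η1 ^ n) := by
    intro n
    obtain ⟨u1, u2⟩ := hp n
    have : ((n : ℝ) - betaTKF lam t) ^ 2 ≤ ((n : ℝ) + 1) ^ 2 := by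
      have hn : (0 : ℝ) ≤ n := Nat.cast_nonneg n
      nlinarith
    gcongr
  unfold sdev
  refine Real.sqrt_le_sqrt ?_
  refine Summable.tsum_le_tsum hterm ?_ hsum
  exact Summable.of_nonneg_of_le (fun n => mul_nonneg (sq_nonneg _) (hp n).1) hterm hsum

/-- Matching point masses: for every integer point `j` of the subinterval `J_{r+1}`,
both `P(S_M(λ,h1) = j)` and `P(S_M(λ,h2) = j)` are at least `c8·c9/(K√(M-1))`. -/
theorem pointwise_overlap (h1 h2 lamstar c1 c2 : ℝ)
    (hh : h1 > h2) (hh2 : h2 > 0) (hl : lamstar ∈ Set.Ioo (0 : ℝ) 1)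
    (hc1 : 0 < c1) (hc1' : c1 < 1) (hc2 : 1 < c2) :
    ∃ K : ℕ, 0 < K ∧ ∃ c8 c9 : ℝ, 0 < c8 ∧ 0 < c9 ∧
      ∀ lam ∈ Set.Ico lamstar (1 : ℝ), ∀ M : ℕ,
        c1 / (1 - lam) ≤ (M : ℝ) → (M : ℝ) ≤ c2 / (1 - lam) → 2 ≤ M →
        ∀ r : ℤ, (((|r| + 2 : ℤ) : ℝ)) * (K : ℝ) ≤ Real.sqrt ((M : ℝ) - 1) →
        ∀ j : ℕ,
          (j : ℝ) ∈ Set.Ioo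
            (((M : ℝ) - 1) * betaTKF lam h1 + ((r : ℝ) + 1) * (K : ℝ) * sdev lam h1)
            (((M : ℝ) - 1) * betaTKF lam h1 + ((r : ℝ) + 2) * (K : ℝ) * sdev lam h1) →
          c8 * c9 / ((K : ℝ) * Real.sqrt ((M : ℝ) - 1)) ≤
            min (pS lam h1 M j) (pS lam h2 M j) := by
  obtain ⟨hls0, hls1⟩ := hl
  have hh1 : 0 < h1 := hh2.trans hh
  have hc20 : 0 < c2 := by linarith
  obtain ⟨C, hC0, hC⟩ := sdev_bound h1 hh1
  have hA0 : 0 ≤ C + c2 * h1 + 1 := by positivity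
  obtain ⟨ca, hca, Na, ha⟩ := pS_lower h1 lamstar c2 (C + c2 * h1 + 1) hh1 hls0 hc20 hA0
  obtain ⟨cb, hcb, Nb, hb⟩ := pS_lower h2 lamstar c2 (C + c2 * h1 + 1) hh2 hls0 hc20 hA0
  refine ⟨⌈max Na Nb⌉₊ + 2, by omega, min ca cb, 1, lt_min hca hcb, one_pos, ?_⟩
  intro lam hlam M _ hM2 hM r hr j hj
  obtain ⟨hlam0, hlam1⟩ := hlam
  have hlampos : 0 < lam := lt_of_lt_of_le hls0 hlam0
  set K := ⌈max Na Nb⌉₊ + 2 with hK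
  have hKN : max Na Nb ≤ K := by
    rw [hK]; push_cast; linarith [Nat.le_ceil (max Na Nb)]
  have hK2 : (2 : ℝ) ≤ K := by
    rw [hK]; push_cast; linarith [(Nat.cast_nonneg ⌈max Na Nb⌉₊ : (0 : ℝ) ≤ _)]
  have hMr : (2 : ℝ) ≤ M := by exact_mod_cast hM
  set s := √((M : ℝ) - 1) with hs
  have hsS : s ≤ √(M : ℝ) := Real.sqrt_le_sqrt (by linarith)
  have hs1 : 1 ≤ s := by rw [hs, Real.one_le_sqrt]; linarith
  have hS2 : √(M : ℝ) ≤ 2 * s := by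
    rw [Real.sqrt_le_left (by linarith)]
    have : s ^ 2 = (M : ℝ) - 1 := Real.sq_sqrt (by linarith)
    nlinarith
  have hS0 : 0 < √(M : ℝ) := by linarith
  push_cast at hr
  have hr0 : 0 ≤ |(r : ℝ)| := abs_nonneg _
  have hKs : (K : ℝ) ≤ s := by nlinarith
  have hMl : (M : ℝ) * (1 - lam) ≤ c2 := by
    rwa [le_div_iff₀ (by linarith)] at hM2
  have hσ := hC lam hlampos hlam1
  have hσ0 : 0 ≤ sdev lam h1 := Real.sqrt_nonneg _
  set σ := sdev lam h1 with hσd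
  have hβ1 : betaTKF lam h1 ≤ 1 := by
    unfold betaTKF; rw [Real.exp_le_one_iff]; nlinarith
  have hβ0 : 1 - (1 - lam) * h1 ≤ betaTKF lam h1 := by
    have := Real.add_one_le_exp (-(1 - lam) * h1)
    unfold betaTKF; linarith
  have hβp : 0 < betaTKF lam h1 := Real.exp_pos _
  set β := betaTKF lam h1 with hβd
  obtain ⟨hj1, hj2⟩ := hj
  have hrl := neg_abs_le (r : ℝ)
  have hru := le_abs_self (r : ℝ)
  have hK0 : (0 : ℝ) ≤ K := by linarith
  have k1 : -s ≤ ((r : ℝ) + 1) * K := by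
    have := mul_le_mul_of_nonneg_right (show -(|(r : ℝ)| + 2) ≤ r + 1 by linarith) hK0
    linarith
  have k2 : ((r : ℝ) + 2) * K ≤ s := by
    have := mul_le_mul_of_nonneg_right (show (r : ℝ) + 2 ≤ |(r : ℝ)| + 2 by linarith) hK0
    linarith
  have hsσ : s * σ ≤ s * C := mul_le_mul_of_nonneg_left hσ (by linarith)
  have k3 : -(s * C) ≤ ((r : ℝ) + 1) * K * σ := by
    have := mul_le_mul_of_nonneg_right k1 hσ0
    linarith
  have k4 : ((r : ℝ) + 2) * K * σ ≤ s * C := by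
    have := mul_le_mul_of_nonneg_right k2 hσ0
    linarith
  have k5 : ((M : ℝ) - 1) * β ≤ M := by
    have := mul_le_mul_of_nonneg_left hβ1 (show 0 ≤ (M : ℝ) - 1 by linarith)
    linarith
  have k6 : (M : ℝ) - (c2 * h1 + 1) ≤ (M - 1) * β := by
    have : (M : ℝ) * (1 - lam) * h1 ≤ c2 * h1 := by gcongr
    have h7 := mul_le_mul_of_nonneg_left hβ0 (show 0 ≤ (M : ℝ) by linarith)
    linarith
  have hSC : s * C ≤ √(M : ℝ) * C := by gcongr
  have k7 : c2 * h1 + 1 ≤ (c2 * h1 + 1) * √(M : ℝ) := by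
    have : 0 < c2 * h1 + 1 := by positivity
    exact le_mul_of_one_le_right this.le (by linarith)
  have hjM : |(j : ℝ) - M| ≤ (C + c2 * h1 + 1) * √(M : ℝ) := by
    rw [abs_le]
    constructor <;> linarith
  have hlow : ∀ c : ℝ, 0 < c → min ca cb ≤ c → min ca cb * 1 / (K * s) ≤ c / √(M : ℝ) := by
    intro c hc hcc
    rw [mul_one]
    have : √(M : ℝ) ≤ K * s := hS2.trans (mul_le_mul_of_nonneg_right hK2 (by linarith))
    gcongr
  refine le_min ?_ ?_
  · exact (hlow ca hca (min_le_left _ _)).trans (ha lam hlam0 hlam1 M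
      (by linarith [le_max_left Na Nb]) hMl j hjM)
  · exact (hlow cb hcb (min_le_right _ _)).trans (hb lam hlam0 hlam1 M
      (by linarith [le_max_right Na Nb]) hMl j hjM)
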